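/- For a binary linear code C with odd minimum distance d: every codeword c_1 ∈ C of weight d satisfies |LH(c_1)| = C(d, (d+1)/2), and every codeword c_2 ∈ C of weight d+1 satisfies |LH^-(c_2)| = C(d, (d+1)/2), where C(m,r) denotes the binomial coefficient. -/

import Mathlib

/-- Support of a binary vector: the set of nonzero coordinates. -/
def supp {n : ℕ} (x : Fin n → ZMod 2) : Finset (Fin n) :=
  Finset.univ.filter (fun i => x i ≠ 0)

/-- Hamming weight. -/
def wt {n : ℕ} (x : Fin n → ZMod 2) : ℕ := (supp x).card

/-- Numerical value v(x) = Σ_{i=1}^n x_i 2^(n-i) (0-based: exponent n-1-i). -/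
def nval {n : ℕ} (x : Fin n → ZMod 2) : ℕ :=
  ∑ i : Fin n, (x i).val * 2 ^ (n - 1 - (i : ℕ))

/-- The total order ⪯ : first by weight, ties broken by numerical value. -/
def ple {n : ℕ} (x y : Fin n → ZMod 2) : Prop :=
  wt x < wt y ∨ (wt x = wt y ∧ nval x ≤ nval y)

/-- The strict version ≺ of ⪯. -/
def plt {n : ℕ} (x y : Fin n → ZMod 2) : Prop := ple x y ∧ x ≠ y

/-- Covering order: x ⊆ y iff S(x) ⊆ S(y). -/
def covers {n : ℕ} (x y : Fin n → ZMod 2) : Prop := supp x ⊆ supp y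

/-- v is the coset leader of its coset of C, i.e. the ⪯-minimum element
(u ranges over the coset of v: u + v ∈ C). -/
def IsCosetLeader {n : ℕ} (C : Submodule (ZMod 2) (Fin n → ZMod 2))
    (v : Fin n → ZMod 2) : Prop :=
  ∀ u, u + v ∈ C → ple v u

/-- E⁰(C): the set of correctable errors (coset leaders). -/
def E0 {n : ℕ} (C : Submodule (ZMod 2) (Fin n → ZMod 2)) : Set (Fin n → ZMod 2) :=
  {v | IsCosetLeader C v}

/-- E¹(C): the set of uncorrectable errors. -/
def E1 {n : ℕ} (C : Submodule (ZMod 2) (Fin n → ZMod 2)) : Set (Fin n → ZMod 2) :=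
  {v | ¬ IsCosetLeader C v}

/-- M¹(C): the ⊆-minimal elements of E¹(C). -/
def M1 {n : ℕ} (C : Submodule (ZMod 2) (Fin n → ZMod 2)) : Set (Fin n → ZMod 2) :=
  {v ∈ E1 C | ∀ u ∈ E1 C, covers u v → u = v}

/-- v is a larger half of c: v is ⊆-minimal among vectors u with u + c ≺ u. -/
def IsLH {n : ℕ} (c v : Fin n → ZMod 2) : Prop :=
  plt (v + c) v ∧ ∀ u, plt (u + c) u → covers u v → u = v

/-- LH(c): the set of larger halves of c. -/
def LH {n : ℕ} (c : Fin n → ZMod 2) : Set (Fin n → ZMod 2) := {v | IsLH c v}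

/-- LH(U) = ∪_{c ∈ U} LH(c). -/
def LHset {n : ℕ} (U : Set (Fin n → ZMod 2)) : Set (Fin n → ZMod 2) :=
  ⋃ c ∈ U, LH c

/-- LH⁻(c): larger halves of c of weight w(c)/2 (for even-weight c). -/
def LHm {n : ℕ} (c : Fin n → ZMod 2) : Set (Fin n → ZMod 2) :=
  {v ∈ LH c | 2 * wt v = wt c}

/-- A_i(U): elements of U of weight i. -/
def Aw {n : ℕ} (U : Set (Fin n → ZMod 2)) (i : ℕ) : Set (Fin n → ZMod 2) :=
  {v ∈ U | wt v = i}

/-- C has minimum distance d. -/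
def HasMinDist {n : ℕ} (C : Submodule (ZMod 2) (Fin n → ZMod 2)) (d : ℕ) : Prop :=
  (∃ c ∈ C, c ≠ 0 ∧ wt c = d) ∧ ∀ c ∈ C, c ≠ 0 → d ≤ wt c

/-- T is a trial set for C. -/
def IsTrialSet {n : ℕ} (C : Submodule (ZMod 2) (Fin n → ZMod 2))
    (T : Set (Fin n → ZMod 2)) : Prop :=
  T ⊆ (C : Set (Fin n → ZMod 2)) \ {0} ∧ M1 C ⊆ LHset T

/-- l(x) = min S(x), the leftmost nonzero coordinate (⊤ if x = 0). -/
def lm {n : ℕ} (x : Fin n → ZMod 2) : WithTop (Fin n) := (supp x).min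

/-- The coordinatewise "and" of two vectors: support is S(x) ∩ S(y). -/
def vand {n : ℕ} (x y : Fin n → ZMod 2) : Fin n → ZMod 2 := fun i => x i * y i

lemma mem_supp {n : ℕ} {x : Fin n → ZMod 2} {i : Fin n} : i ∈ supp x ↔ x i ≠ 0 := by
  simp [supp]

lemma supp_injective {n : ℕ} : Function.Injective (supp (n := n)) := by
  intro x y h
  funext i
  have hi : x i ≠ 0 ↔ y i ≠ 0 := by rw [← mem_supp, ← mem_supp, h]
  revert hi
  generalize x i = a
  generalize y i = b
  revert a b
  decide

lemma supp_surjective {n : ℕ} : Function.Surjective (supp (n := n)) := by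
  intro S
  refine ⟨fun i => if i ∈ S then 1 else 0, ?_⟩
  ext i
  simp [mem_supp]

lemma supp_add {n : ℕ} (x y : Fin n → ZMod 2) : supp (x + y) = symmDiff (supp x) (supp y) := by
  ext i
  simp only [Finset.mem_symmDiff, mem_supp, Pi.add_apply]
  generalize x i = a
  generalize y i = b
  revert a b
  decide

lemma nval_eq_sum_supp {n : ℕ} (x : Fin n → ZMod 2) :
    nval x = ∑ i ∈ supp x, 2 ^ (n - 1 - (i : ℕ)) := by
  rw [nval, supp, Finset.sum_filter]
  refine Finset.sum_congr rfl fun i _ => ?_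
  generalize x i = a
  have ha : a = 0 ∨ a = 1 := by revert a; decide
  rcases ha with rfl | rfl
  · simp
  · simp [ZMod.val_one]

lemma sum_two_pow_lt {n : ℕ} (m : Fin n) (S : Finset (Fin n)) (hS : ∀ i ∈ S, m < i) :
    ∑ i ∈ S, 2 ^ (n - 1 - (i : ℕ)) < 2 ^ (n - 1 - (m : ℕ)) := by
  have hinj : Set.InjOn (fun i : Fin n => n - 1 - (i : ℕ)) S := by
    intro i _ j _ h
    simp only at h
    ext
    omega
  rw [← Finset.sum_image (f := fun k => 2 ^ k) hinj]
  refine Nat.geomSum_lt le_rfl fun k hk => ?_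
  obtain ⟨i, hi, rfl⟩ := Finset.mem_image.1 hk
  have := hS i hi
  rw [Fin.lt_def] at this
  omega

lemma sum_sdiff_lt_sum_inter {n : ℕ} {S T : Finset (Fin n)} {m : Fin n} (hm : m ∈ T)
    (hmin : ∀ i ∈ T, m ≤ i) (hS : m ∈ S) :
    ∑ i ∈ T \ S, 2 ^ (n - 1 - (i : ℕ)) < ∑ i ∈ S ∩ T, 2 ^ (n - 1 - (i : ℕ)) := by
  refine (sum_two_pow_lt m _ fun i hi => ?_).trans_le
    (Finset.single_le_sum (f := fun i : Fin n => 2 ^ (n - 1 - (i : ℕ)))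
      (fun _ _ => Nat.zero_le _) (Finset.mem_inter.2 ⟨hS, hm⟩))
  rw [Finset.mem_sdiff] at hi
  exact lt_of_le_of_ne (hmin i hi.1) fun h => hi.2 (h ▸ hS)

lemma nval_add_le_iff {n : ℕ} {c : Fin n → ZMod 2} {m : Fin n} (hm : m ∈ supp c)
    (hmin : ∀ i ∈ supp c, m ≤ i) (v : Fin n → ZMod 2) :
    nval (v + c) ≤ nval v ↔ m ∈ supp v := by
  rw [nval_eq_sum_supp, nval_eq_sum_supp, supp_add, symmDiff_def, Finset.sup_eq_union,
    Finset.sum_union disjoint_sdiff_sdiff,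
    ← Finset.sum_inter_add_sum_sdiff (supp v) (supp c)]
  by_cases h : m ∈ supp v
  · have := sum_sdiff_lt_sum_inter hm hmin h
    simp only [h, iff_true]
    omega
  · have := sum_sdiff_lt_sum_inter (S := (supp v)ᶜ) hm hmin (Finset.mem_compl.2 h)
    have h₁ : supp c \ (supp v)ᶜ = supp v ∩ supp c := by ext; simp [and_comm]
    have h₂ : (supp v)ᶜ ∩ supp c = supp c \ supp v := by ext; simp [and_comm]
    rw [h₁, h₂] at this
    simp only [h, iff_false]
    omega

lemma wt_add {n : ℕ} (v c : Fin n → ZMod 2) :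
    wt (v + c) + 2 * (supp v ∩ supp c).card = wt v + wt c := by
  rw [wt, wt, wt, supp_add, symmDiff_def, Finset.sup_eq_union,
    Finset.card_union_of_disjoint disjoint_sdiff_sdiff]
  have h₁ := Finset.card_sdiff_add_card_inter (supp v) (supp c)
  have h₂ := Finset.card_sdiff_add_card_inter (supp c) (supp v)
  rw [Finset.inter_comm] at h₂
  omega

lemma plt_add_iff {n : ℕ} {c : Fin n → ZMod 2} {m : Fin n} (hm : m ∈ supp c)
    (hmin : ∀ i ∈ supp c, m ≤ i) (v : Fin n → ZMod 2) :
    plt (v + c) v ↔ wt c < 2 * (supp v ∩ supp c).card ∨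
      (wt c = 2 * (supp v ∩ supp c).card ∧ m ∈ supp v) := by
  have hc : v + c ≠ v := by
    intro h
    rw [add_eq_left] at h
    exact mem_supp.1 hm (congrFun h m)
  have := wt_add v c
  rw [plt, ple, nval_add_le_iff hm hmin, and_iff_left hc]
  refine or_congr (by omega) (and_congr_left fun _ => by omega)

lemma exists_min_supp {n : ℕ} {c : Fin n → ZMod 2} (hc : 0 < wt c) :
    ∃ m ∈ supp c, ∀ i ∈ supp c, m ≤ i :=
  Finset.exists_min_image (supp c) id (Finset.card_pos.1 hc)

lemma isLH_iff_of_odd {n : ℕ} {c : Fin n → ZMod 2} (hc : Odd (wt c)) (v : Fin n → ZMod 2) :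
    IsLH c v ↔ supp v ⊆ supp c ∧ (supp v).card = (wt c + 1) / 2 := by
  obtain ⟨k, hk⟩ := hc
  obtain ⟨m, hm, hmin⟩ := exists_min_supp (c := c) (by omega)
  have key : ∀ u, plt (u + c) u ↔ (wt c + 1) / 2 ≤ (supp u ∩ supp c).card := fun u => by
    rw [plt_add_iff hm hmin]
    omega
  simp only [IsLH, key, covers]
  constructor
  · rintro ⟨h₁, h₂⟩
    obtain ⟨U, hU, hcard⟩ := Finset.exists_subset_card_eq h₁
    obtain ⟨u, rfl⟩ := supp_surjective U
    have huc : supp u ⊆ supp c := hU.trans Finset.inter_subset_right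
    obtain rfl := h₂ u (by rw [Finset.inter_eq_left.2 huc, hcard])
      (hU.trans Finset.inter_subset_left)
    exact ⟨huc, hcard⟩
  · rintro ⟨h₁, h₂⟩
    refine ⟨by rw [Finset.inter_eq_left.2 h₁, h₂], fun u hu huv => supp_injective ?_⟩
    refine Finset.eq_of_subset_of_card_le huv ?_
    rw [h₂]
    exact hu.trans (Finset.card_le_card Finset.inter_subset_left)

lemma mem_LHm_iff {n : ℕ} {c : Fin n → ZMod 2} {m : Fin n} (hm : m ∈ supp c)
    (hmin : ∀ i ∈ supp c, m ≤ i) (v : Fin n → ZMod 2) :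
    v ∈ LHm c ↔ supp v ⊆ supp c ∧ 2 * (supp v).card = wt c ∧ m ∈ supp v := by
  change IsLH c v ∧ 2 * (supp v).card = wt c ↔ _
  simp only [IsLH, plt_add_iff hm hmin, covers]
  constructor
  · rintro ⟨⟨h₁, h₂⟩, h₃⟩
    obtain ⟨u, hu⟩ := supp_surjective (supp v ∩ supp c)
    have huv : u = v := by
      refine h₂ u ?_ (hu ▸ Finset.inter_subset_left)
      rw [hu, Finset.inter_assoc, Finset.inter_self, Finset.mem_inter, and_iff_left hm]
      exact h₁
    subst huv
    have huc : supp u ⊆ supp c := Finset.inter_eq_left.1 hu.symm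
    rw [← hu] at h₁
    exact ⟨huc, h₃, by rcases h₁ with h | h; exacts [by omega, h.2]⟩
  · rintro ⟨h₁, h₂, h₃⟩
    refine ⟨⟨Or.inr ⟨by rw [Finset.inter_eq_left.2 h₁, h₂], h₃⟩, fun u hu huv => ?_⟩, h₂⟩
    refine supp_injective (Finset.eq_of_subset_of_card_le huv ?_)
    have := Finset.card_le_card (Finset.inter_subset_left (s₁ := supp u) (s₂ := supp c))
    omega

lemma ncard_LH_of_odd {n : ℕ} {c : Fin n → ZMod 2} (hc : Odd (wt c)) :
    (LH c).ncard = (wt c).choose ((wt c + 1) / 2) := by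
  have himage : supp '' LH c = ((supp c).powersetCard ((wt c + 1) / 2) : Set _) := by
    ext S
    obtain ⟨v, rfl⟩ := supp_surjective S
    rw [supp_injective.mem_set_image, Finset.mem_coe, Finset.mem_powersetCard]
    exact isLH_iff_of_odd hc v
  rw [← Set.ncard_image_of_injective _ supp_injective, himage, Set.ncard_coe_finset,
    Finset.card_powersetCard, wt]

/-- Complementation in `supp c` maps the larger halves of weight `k` onto the `k`-subsets of
`supp c` that avoid its minimum. -/
lemma ncard_LHm {n k : ℕ} {c : Fin n → ZMod 2} (hk : 0 < k) (hc : wt c = 2 * k) :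
    (LHm c).ncard = (2 * k - 1).choose k := by
  obtain ⟨m, hm, hmin⟩ := exists_min_supp (c := c) (by omega)
  have hinj : Function.Injective fun v => supp (v + c) :=
    supp_injective.comp (add_left_injective c)
  have himage : (fun v => supp (v + c)) '' LHm c =
      (((supp c).erase m).powersetCard k : Set _) := by
    ext S
    obtain ⟨u, rfl⟩ := supp_surjective S
    obtain ⟨v, rfl⟩ : ∃ v, v + c = u := ⟨u - c, sub_add_cancel u c⟩
    rw [hinj.mem_set_image (a := v), mem_LHm_iff hm hmin, Finset.mem_coe,
      Finset.mem_powersetCard, Finset.subset_erase]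
    have hadd := wt_add v c
    have hsub : supp (v + c) ⊆ supp c ↔ supp v ⊆ supp c := by
      simp only [supp_add, Finset.subset_iff, Finset.mem_symmDiff]
      exact forall_congr' fun i => by tauto
    have hmem : m ∉ supp (v + c) ↔ m ∈ supp v := by
      rw [supp_add, Finset.mem_symmDiff]
      tauto
    rw [hsub, hmem, and_assoc, and_comm (a := m ∈ supp v)]
    refine and_congr_right fun h => and_congr_left fun _ => ?_
    rw [Finset.inter_eq_left.2 h] at hadd
    simp only [wt] at hadd hc ⊢
    omega
  rw [← Set.ncard_image_of_injective _ hinj, himage, Set.ncard_coe_finset,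
    Finset.card_powersetCard, Finset.card_erase_of_mem hm, ← wt, hc]

/-- |LH(c₁)| = C(d,(d+1)/2) for w(c₁)=d, and
|LH⁻(c₂)| = C(d,(d+1)/2) for w(c₂)=d+1, d odd. -/
theorem stmt9 {n : ℕ} (C : Submodule (ZMod 2) (Fin n → ZMod 2)) (d : ℕ)
    (hd : HasMinDist C d) (hodd : Odd d) :
    (∀ c1 ∈ C, wt c1 = d → (LH c1).ncard = Nat.choose d ((d + 1) / 2)) ∧
    (∀ c2 ∈ C, wt c2 = d + 1 → (LHm c2).ncard = Nat.choose d ((d + 1) / 2)) := by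
  refine ⟨fun c _ hc => ?_, fun c _ hc => ?_⟩
  · rw [ncard_LH_of_odd (hc ▸ hodd), hc]
  · obtain ⟨k, rfl⟩ := hodd
    rw [ncard_LHm (k := k + 1) (by omega) (by omega)]
    congr 1
    omega
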